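/- Let k be a positive rational number such that √k is irrational. Then there exists an absolute positive constant c₀ such that for all γ, γ' ∈ (0, 1/10) with γ/γ' < c₀ the following holds: there exist positive constants C = C(k, γ, γ') and χ = χ(γ, γ') such that for every N ∈ [1, ∞) and every ξ ∈ m₂(N; k, γ, γ'), one has | (1/N) ∑_{n=1}^{⌊N⌋} e(ξ n⌊n√k⌋) | ≤ C N^{−χ}. -/

import Mathlib

/-- `e(x) = exp(2πix)`. -/
noncomputable def expc (x : ℝ) : ℂ := Complex.exp (2 * Real.pi * Complex.I * x)

/-- `‖x‖ = min_{n ∈ ℤ} |x − n|`, the distance from `x` to the nearest integer. -/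
noncomputable def distToInt (x : ℝ) : ℝ := |x - (round x : ℤ)|

/-- Admissible indices `(a, b, q)` for the arcs at scale `N` with parameter `γ`:
`q ∈ {1,…,⌊N^γ⌋}`, `b ∈ ℤ` with `|b| ≤ N^γ`, `a ∈ {1,…,q}` and `gcd(a,b,q) = 1`. -/
def goodIdx (N γ : ℝ) (a b : ℤ) (q : ℕ) : Prop :=
  0 < q ∧ (q : ℝ) ≤ N ^ γ ∧ |(b : ℝ)| ≤ N ^ γ ∧ 1 ≤ a ∧ a ≤ (q : ℤ) ∧
    Int.gcd a (Int.gcd b (q : ℤ)) = 1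

/-- The major arcs `M(N; k, γ, γ')`. -/
noncomputable def majorArcs (k N γ γ' : ℝ) : Set ℝ :=
  {ξ | ξ ∈ Set.Ico (-(1 / 2) : ℝ) (1 / 2) ∧ ∃ (a b : ℤ) (q : ℕ), goodIdx N γ a b q ∧
    distToInt (ξ - ((a : ℝ) + (b : ℝ) * Real.sqrt k) / q) ≤ N ^ (-2 + γ')}

/-- The minor arcs `m(N; k, γ, γ') = [−1/2, 1/2) \ M(N; k, γ, γ')`. -/
noncomputable def minorArcs (k N γ γ' : ℝ) : Set ℝ :=
  Set.Ico (-(1 / 2) : ℝ) (1 / 2) \ majorArcs k N γ γ'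

/-- The exponential sum `(1/N) ∑_{n=1}^{⌊N⌋} e(ξ n⌊n√k⌋)`. -/
noncomputable def expSum (k N ξ : ℝ) : ℂ :=
  ((N : ℝ) : ℂ)⁻¹ * ∑ n ∈ Finset.Icc 1 (⌊N⌋).toNat,
      expc (ξ * ((n : ℝ) * (⌊(n : ℝ) * Real.sqrt k⌋ : ℝ)))

/-- The wide arcs `⋃ M̃_{a,b,q}` with radius `N^{−1+γ}`. -/
noncomputable def wideArcs (k N γ : ℝ) : Set ℝ :=
  {ξ | ξ ∈ Set.Ico (-(1 / 2) : ℝ) (1 / 2) ∧ ∃ (a b : ℤ) (q : ℕ), goodIdx N γ a b q ∧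
    distToInt (ξ - ((a : ℝ) + (b : ℝ) * Real.sqrt k) / q) ≤ N ^ (-1 + γ)}

/-- `m₂(N; k, γ, γ') = (⋃ M̃_{a,b,q}) \ M(N; k, γ, γ')`. -/
noncomputable def minor2 (k N γ γ' : ℝ) : Set ℝ :=
  wideArcs k N γ \ majorArcs k N γ γ'

theorem norm_expc (x : ℝ) : ‖expc x‖ = 1 := by
  have h : expc x = Complex.exp (((2 * Real.pi * x : ℝ) : ℂ) * Complex.I) := by
    unfold expc; congr 1; push_cast; ring
  rw [h, Complex.norm_exp_ofReal_mul_I]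

theorem expc_add (x y : ℝ) : expc (x + y) = expc x * expc y := by
  unfold expc; rw [← Complex.exp_add]; congr 1; push_cast; ring

theorem expc_intCast (n : ℤ) : expc n = 1 := by
  unfold expc; rw [Complex.exp_eq_one_iff]; exact ⟨n, by push_cast; ring⟩

theorem conj_expc (x : ℝ) : (starRingEnd ℂ) (expc x) = expc (-x) := by
  unfold expc
  rw [← Complex.exp_conj]
  congr 1
  simp only [map_mul, Complex.conj_I, Complex.conj_ofReal, map_ofNat]
  push_cast
  ring

theorem norm_expc_sub_one (x : ℝ) : ‖expc x - 1‖ = 2 * |Real.sin (Real.pi * x)| := by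
  have h : expc x = Complex.exp (Complex.I * ((2 * Real.pi * x : ℝ) : ℂ)) := by
    unfold expc; congr 1; push_cast; ring
  rw [h, Complex.norm_exp_I_mul_ofReal_sub_one, norm_mul, Real.norm_eq_abs, Real.norm_eq_abs,
    abs_two]
  congr 3; ring

theorem norm_expc_sub_one_le (x : ℝ) : ‖expc x - 1‖ ≤ 2 * Real.pi * |x| := by
  rw [norm_expc_sub_one]
  have h : |Real.sin (Real.pi * x)| ≤ |Real.pi * x| := Real.abs_sin_le_abs
  rw [abs_mul, abs_of_pos Real.pi_pos] at h
  linarith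

theorem four_mul_abs_le_norm_expc_sub_one {x : ℝ} (hx : |x| ≤ 1 / 2) :
    4 * |x| ≤ ‖expc x - 1‖ := by
  rw [norm_expc_sub_one]
  have hpi := Real.pi_pos
  have h : 2 / Real.pi * |Real.pi * x| ≤ |Real.sin (Real.pi * x)| := by
    apply Real.mul_abs_le_abs_sin
    rw [abs_mul, abs_of_pos hpi]
    nlinarith
  rw [abs_mul, abs_of_pos hpi, ← mul_assoc, div_mul_cancel₀ _ hpi.ne'] at h
  linarith

/-- A bound for geometric sums that needs no smallness of the frequency. -/
theorem norm_sum_expc_mul_le {α : ℝ} (hα : α ≠ 0) (X : ℕ) :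
    ‖∑ n ∈ Finset.range X, expc (α * n)‖ ≤ 1 / |α| + 2 * X * |α| := by
  have hpos : 0 < |α| := abs_pos.mpr hα
  rcases le_or_gt |α| (1 / 2) with h | h
  · have hpow : ∀ n : ℕ, expc (α * n) = expc α ^ n := by
      intro n
      unfold expc
      rw [← Complex.exp_nat_mul]; congr 1; push_cast; ring
    have hgeom := geom_sum_mul (expc α) X
    simp_rw [hpow]
    have h4 := four_mul_abs_le_norm_expc_sub_one h
    have h2 : ‖expc α ^ X - 1‖ ≤ 2 := by
      refine (norm_sub_le _ _).trans ?_
      rw [norm_pow, norm_expc]; norm_num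
    rw [← hgeom, norm_mul] at h2
    have h5 : ‖∑ n ∈ Finset.range X, expc α ^ n‖ * (4 * |α|) ≤ 2 :=
      (mul_le_mul_of_nonneg_left h4 (norm_nonneg _)).trans h2
    have h6 : ‖∑ n ∈ Finset.range X, expc α ^ n‖ ≤ 1 / |α| := by
      rw [le_div_iff₀ hpos]; linarith
    have : 0 ≤ 2 * X * |α| := by positivity
    linarith
  · have h1 : ‖∑ n ∈ Finset.range X, expc (α * n)‖ ≤ X := by
      refine (norm_sum_le _ _).trans ?_
      simp [norm_expc]
    have h2 : (X : ℝ) ≤ 2 * X * |α| := by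
      have : (0 : ℝ) ≤ X := by positivity
      nlinarith
    have : 0 ≤ 1 / |α| := by positivity
    linarith

theorem norm_sum_sub_sum_shift_le {f : ℕ → ℂ} (hf : ∀ n, ‖f n‖ ≤ 1) (X M t : ℕ) :
    ‖∑ n ∈ Finset.range X, f (M + n) - ∑ n ∈ Finset.range X, f (M + n + t)‖ ≤ 2 * t := by
  have h1 := Finset.sum_range_add (fun n => f (M + n)) X t
  have h2 := Finset.sum_range_add (fun n => f (M + n)) t X
  rw [add_comm t X, h1] at h2
  have h3 : ∀ n, M + (t + n) = M + n + t := fun n => by ring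
  simp_rw [h3] at h2
  have h4 : ∑ n ∈ Finset.range X, f (M + n) - ∑ n ∈ Finset.range X, f (M + n + t) =
      ∑ n ∈ Finset.range t, f (M + n) - ∑ n ∈ Finset.range t, f (M + (X + n)) := by
    linear_combination h2
  rw [h4]
  have hb : ∀ g : ℕ → ℂ, (∀ n, ‖g n‖ ≤ 1) → ‖∑ n ∈ Finset.range t, g n‖ ≤ t := by
    intro g hg
    refine (norm_sum_le_of_le _ fun n _ => hg n).trans ?_
    simp
  have h5 := hb (fun n => f (M + n)) fun n => hf _
  have h6 := hb (fun n => f (M + (X + n))) fun n => hf _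
  refine (norm_sub_le _ _).trans ?_
  linarith

/-- Van der Corput's inequality along the multiples of a fixed shift `h`. -/
theorem norm_sum_le_of_correlations {f : ℕ → ℂ} (hf : ∀ n, ‖f n‖ ≤ 1) {X L h : ℕ} (hL : 0 < L)
    {B : ℝ} (hB : 0 ≤ B)
    (hcorr : ∀ g M : ℕ, 1 ≤ g → g < L →
      ‖∑ n ∈ Finset.range X, f (M + n + g * h) * (starRingEnd ℂ) (f (M + n))‖ ≤ B) (M : ℕ) :
    ‖∑ n ∈ Finset.range X, f (M + n)‖ ≤ √((X : ℝ) ^ 2 / L + X * B) + 2 * (L * h) := by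
  set S := ∑ n ∈ Finset.range X, f (M + n) with hS
  set W : ℕ → ℂ := fun n => ∑ l ∈ Finset.range L, f (M + n + l * h) with hW
  have hLr : (0 : ℝ) < L := by exact_mod_cast hL
  have hpair : ∀ l l' : ℕ, l < L → l' < l →
      ‖∑ n ∈ Finset.range X, f (M + n + l * h) * (starRingEnd ℂ) (f (M + n + l' * h))‖ ≤ B := by
    intro l l' hl hl'
    obtain ⟨g, rfl⟩ := Nat.exists_eq_add_of_lt hl'
    have := hcorr (g + 1) (M + l' * h) (by omega) (by omega)
    have e1 : ∀ n, M + l' * h + n + (g + 1) * h = M + n + (l' + g + 1) * h := fun n => by ring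
    have e2 : ∀ n, M + l' * h + n = M + n + l' * h := fun n => by ring
    simp_rw [e1, e2] at this
    exact this
  have hterm : ∀ l ∈ Finset.range L, ∀ l' ∈ Finset.range L,
      ‖∑ n ∈ Finset.range X, f (M + n + l * h) * (starRingEnd ℂ) (f (M + n + l' * h))‖ ≤
        (if l = l' then (X : ℝ) else 0) + B := by
    intro l hl l' hl'
    rw [Finset.mem_range] at hl hl'
    rcases lt_trichotomy l l' with h1 | h1 | h1
    · rw [if_neg h1.ne, zero_add, ← Complex.norm_conj, map_sum]
      simp_rw [map_mul, Complex.conj_conj, mul_comm ((starRingEnd ℂ) _)]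
      exact hpair l' l hl' h1
    · subst h1
      rw [if_pos rfl]
      refine (norm_sum_le_of_le (Finset.range X) (f := fun n => f (M + n + l * h) *
        (starRingEnd ℂ) (f (M + n + l * h))) (n := fun _ => (1 : ℝ)) fun n _ => ?_).trans ?_
      · rw [norm_mul, Complex.norm_conj]
        exact mul_le_one₀ (hf _) (norm_nonneg _) (hf _)
      · simpa using hB
    · rw [if_neg h1.ne', zero_add]
      exact hpair l l' hl h1
  have hsq : ∑ n ∈ Finset.range X, ‖W n‖ ^ 2 ≤ L * X + L ^ 2 * B := by
    have e : ((∑ n ∈ Finset.range X, ‖W n‖ ^ 2 : ℝ) : ℂ) =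
        ∑ l ∈ Finset.range L, ∑ l' ∈ Finset.range L, ∑ n ∈ Finset.range X,
          f (M + n + l * h) * (starRingEnd ℂ) (f (M + n + l' * h)) := by
      push_cast
      have : ∀ n, ((‖W n‖ : ℂ)) ^ 2 = ∑ l ∈ Finset.range L, ∑ l' ∈ Finset.range L,
          f (M + n + l * h) * (starRingEnd ℂ) (f (M + n + l' * h)) := by
        intro n
        rw [← Complex.mul_conj', hW, map_sum, Finset.sum_mul_sum]
      simp_rw [this]
      rw [Finset.sum_comm]
      refine Finset.sum_congr rfl fun l _ => ?_
      rw [Finset.sum_comm]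
    have hn : ‖((∑ n ∈ Finset.range X, ‖W n‖ ^ 2 : ℝ) : ℂ)‖ = ∑ n ∈ Finset.range X, ‖W n‖ ^ 2 := by
      rw [Complex.norm_real, Real.norm_eq_abs, abs_of_nonneg]
      positivity
    rw [← hn, e]
    refine (norm_sum_le_of_le _ fun l hl => norm_sum_le_of_le _ fun l' hl' =>
      hterm l hl l' hl').trans (le_of_eq ?_)
    simp only [Finset.sum_add_distrib, Finset.sum_ite_eq, Finset.mem_range, Finset.sum_const,
      Finset.card_range, nsmul_eq_mul]
    rw [Finset.sum_congr rfl fun l hl => if_pos (Finset.mem_range.mp hl)]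
    simp only [Finset.sum_const, Finset.card_range, nsmul_eq_mul]
    ring
  have hV : ‖∑ n ∈ Finset.range X, W n‖ ≤ L * √((X : ℝ) ^ 2 / L + X * B) := by
    have h1 : (∑ n ∈ Finset.range X, ‖W n‖) ^ 2 ≤ X * ∑ n ∈ Finset.range X, ‖W n‖ ^ 2 := by
      simpa using sq_sum_le_card_mul_sum_sq (s := Finset.range X) (f := fun n => ‖W n‖)
    have h2 : (∑ n ∈ Finset.range X, ‖W n‖) ^ 2 ≤ L ^ 2 * ((X : ℝ) ^ 2 / L + X * B) := by
      refine h1.trans ((mul_le_mul_of_nonneg_left hsq (by positivity)).trans (le_of_eq ?_))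
      field_simp
    refine (norm_sum_le _ _).trans ?_
    have h3 := Real.le_sqrt_of_sq_le h2
    rwa [Real.sqrt_mul (by positivity), Real.sqrt_sq hLr.le] at h3
  have hdiff : ‖(L : ℂ) * S - ∑ n ∈ Finset.range X, W n‖ ≤ L * (2 * (L * h)) := by
    have e : (L : ℂ) * S - ∑ n ∈ Finset.range X, W n =
        ∑ l ∈ Finset.range L, (S - ∑ n ∈ Finset.range X, f (M + n + l * h)) := by
      rw [Finset.sum_sub_distrib, hW, Finset.sum_comm]
      simp
    rw [e]
    refine (norm_sum_le_of_le (n := fun _ => 2 * ((L : ℝ) * h)) _ fun l hl => ?_).trans ?_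
    · refine (norm_sum_sub_sum_shift_le hf X M (l * h)).trans ?_
      have : (l : ℝ) ≤ L := by exact_mod_cast (Finset.mem_range.mp hl).le
      push_cast
      gcongr
    · simp
  have hLS : L * ‖S‖ ≤ L * (√((X : ℝ) ^ 2 / L + X * B) + 2 * (L * h)) := by
    have e : (L : ℝ) * ‖S‖ = ‖(L : ℂ) * S‖ := by simp
    have e2 : (L : ℂ) * S = ((L : ℂ) * S - ∑ n ∈ Finset.range X, W n) +
      ∑ n ∈ Finset.range X, W n := by ring
    rw [e, e2]
    refine (norm_add_le _ _).trans ?_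
    linarith
  exact le_of_mul_le_mul_left hLS hLr

open Classical in
/-- If `‖dθ‖ ≥ c/d` for all `d ≥ 1`, few `n` in an interval have `nθ` near an integer. -/
theorem card_near_integer_le {θ c ε : ℝ} (hc : 0 < c) (hε : 0 ≤ ε)
    (hθ : ∀ (d : ℕ) (m : ℤ), 0 < d → c / d ≤ |d * θ - m|) (X M : ℕ) :
    (((Finset.range X).filter fun n => ∃ m : ℤ, |((M + n : ℕ) : ℝ) * θ - m| ≤ ε).card : ℝ) ≤
      1 + X * (2 * ε / c) := by
  set T := (Finset.range X).filter fun n => ∃ m : ℤ, |((M + n : ℕ) : ℝ) * θ - m| ≤ ε with hT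
  set κ := 2 * ε / c with hκ
  have hκ0 : 0 ≤ κ := by positivity
  have hsep : ∀ n ∈ T, ∀ n' ∈ T, n < n' → ⌊(n : ℝ) * κ⌋₊ < ⌊(n' : ℝ) * κ⌋₊ := by
    intro n hn n' hn' hlt
    obtain ⟨m, hm⟩ := (Finset.mem_filter.mp hn).2
    obtain ⟨m', hm'⟩ := (Finset.mem_filter.mp hn').2
    obtain ⟨d, rfl⟩ := Nat.exists_eq_add_of_lt hlt
    have h1 := hθ (d + 1) (m' - m) (by omega)
    have h2 : |((d + 1 : ℕ) : ℝ) * θ - ((m' - m : ℤ) : ℝ)| ≤ 2 * ε := by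
      have e : ((d + 1 : ℕ) : ℝ) * θ - ((m' - m : ℤ) : ℝ) =
          (((M + (n + d + 1) : ℕ) : ℝ) * θ - m') - (((M + n : ℕ) : ℝ) * θ - m) := by
        push_cast; ring
      rw [e]
      exact (abs_sub _ _).trans (by linarith)
    have h3 : 1 ≤ ((d + 1 : ℕ) : ℝ) * κ := by
      have hd : (0 : ℝ) < ((d + 1 : ℕ) : ℝ) := by positivity
      have h4 := (div_le_iff₀ hd).mp (h1.trans h2)
      rw [hκ, ← mul_div_assoc, le_div_iff₀ hc]
      linarith
    rw [Nat.lt_iff_add_one_le]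
    apply Nat.le_floor
    have h5 := Nat.floor_le (mul_nonneg (Nat.cast_nonneg n) hκ0)
    push_cast at h3 ⊢
    linarith
  have hcard : T.card ≤ (Finset.range (⌊(X : ℝ) * κ⌋₊ + 1)).card := by
    refine Finset.card_le_card_of_injOn (fun n => ⌊(n : ℝ) * κ⌋₊) ?_ ?_
    · intro n hn
      have hn1 : n < X := Finset.mem_range.mp (Finset.mem_filter.mp hn).1
      have : (n : ℝ) ≤ X := by exact_mod_cast hn1.le
      simp only [Finset.coe_range, Set.mem_Iio]
      exact Nat.lt_succ_of_le (Nat.floor_le_floor (by gcongr))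
    · intro n hn n' hn' heq
      rcases lt_trichotomy n n' with h | h | h
      · exact absurd heq (hsep n hn n' hn' h).ne
      · exact h
      · exact absurd heq (hsep n' hn' n hn h).ne'
  rw [Finset.card_range] at hcard
  have h1 : (T.card : ℝ) ≤ ⌊(X : ℝ) * κ⌋₊ + 1 := by exact_mod_cast hcard
  have h2 := Nat.floor_le (mul_nonneg (Nat.cast_nonneg X) hκ0)
  linarith

/-- The phase `e(ξ n⌊nθ⌋)`. -/
noncomputable def beattyPhase (ξ θ : ℝ) (n : ℕ) : ℂ :=
  expc (ξ * ((n : ℝ) * (⌊(n : ℝ) * θ⌋ : ℝ)))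

/-- Away from the discontinuities of `n ↦ ⌊nθ⌋`, a shift by `qh` with `hθ²` an integer and `hθ`
close to an integer turns the phase into an almost linear one. -/
theorem beattyPhase_correlation {ξ θ η ε : ℝ} {a b z m' w : ℤ} {q h n : ℕ} (hq : 0 < q)
    (hξ : ξ = (a + b * θ) / q + η + z) (hw : h * θ ^ 2 = w) (hε : q * |h * θ - m'| ≤ ε)
    (hn : ¬ ∃ m : ℤ, |(n : ℝ) * θ - m| ≤ ε) :
    beattyPhase ξ θ (n + q * h) * (starRingEnd ℂ) (beattyPhase ξ θ n) =
      expc (b * θ * q * h * m' + η * q ^ 2 * h * m') * expc (η * q * (h * θ + m') * n) *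
        expc (-(Int.fract (n * θ) * (b * (h * θ - m') + η * q * h))) := by
  have hq' : (q : ℝ) ≠ 0 := by exact_mod_cast hq.ne'
  push Not at hn
  set m := ⌊(n : ℝ) * θ⌋ with hm
  have hfr : Int.fract ((n : ℝ) * θ) = n * θ - m := rfl
  have ht : |(q : ℝ) * (h * θ - m')| ≤ ε := by
    rwa [abs_mul, Nat.abs_cast]
  have hfloor : ⌊((n + q * h : ℕ) : ℝ) * θ⌋ = m + q * m' := by
    rw [Int.floor_eq_iff]
    have h1 := hn m
    have h2 := hn (m + 1)
    have h3 : 0 ≤ (n : ℝ) * θ - m := by linarith [Int.floor_le ((n : ℝ) * θ)]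
    have h4 : (n : ℝ) * θ - ((m + 1 : ℤ) : ℝ) < 0 := by
      push_cast; linarith [Int.lt_floor_add_one ((n : ℝ) * θ)]
    rw [abs_of_nonneg h3] at h1
    rw [abs_of_neg h4] at h2
    have h5 := abs_le.mp ht
    push_cast at h2 ⊢
    constructor <;> nlinarith [h5.1, h5.2]
  rw [beattyPhase, beattyPhase, conj_expc, hfloor, ← hm, ← expc_add, ← expc_add, ← expc_add, hfr]
  have key : ξ * (((n + q * h : ℕ) : ℝ) * ((m + q * m' : ℤ) : ℝ)) + -(ξ * (n * m)) =
      b * θ * q * h * m' + η * q ^ 2 * h * m' + η * q * (h * θ + m') * n +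
        -((n * θ - m) * (b * (h * θ - m') + η * q * h)) +
      ((z * (q * (n * m' + h * m + q * h * m')) + a * (n * m' + h * m + q * h * m')
        + b * (w * n + m * m') : ℤ) : ℝ) := by
    rw [hξ]
    push_cast
    rw [← hw]
    field_simp
    ring
  rw [key, expc_add, expc_intCast, mul_one]

theorem norm_correlation_le {ξ θ η c : ℝ} {a b z m' w : ℤ} {q h : ℕ} (hc : 0 < c)
    (hθ : ∀ (d : ℕ) (m : ℤ), 0 < d → c / d ≤ |d * θ - m|) (hq : 0 < q)
    (hξ : ξ = (a + b * θ) / q + η + z) (hw : h * θ ^ 2 = w) (hα : η * q * (h * θ + m') ≠ 0)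
    (X M : ℕ) :
    ‖∑ n ∈ Finset.range X,
        beattyPhase ξ θ (M + n + q * h) * (starRingEnd ℂ) (beattyPhase ξ θ (M + n))‖ ≤
      1 / |η * q * (h * θ + m')| + 2 * X * |η * q * (h * θ + m')| +
        X * (2 * Real.pi * (|(b : ℝ)| * |h * θ - m'| + |η| * q * h)) +
        2 * (1 + X * (2 * (q * |h * θ - m'|) / c)) := by
  classical
  set α := η * q * (h * θ + m') with hαdef
  set ε := (q : ℝ) * |h * θ - m'| with hε
  set D := |(b : ℝ)| * |h * θ - m'| + |η| * q * h with hD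
  have hD0 : 0 ≤ D := by positivity
  set β := b * θ * q * h * m' + η * q ^ 2 * h * m' with hβ
  set lin : ℕ → ℂ := fun n => expc β * expc (α * ((M + n : ℕ) : ℝ)) with hlin
  set G : ℕ → ℂ := fun n =>
    beattyPhase ξ θ (M + n + q * h) * (starRingEnd ℂ) (beattyPhase ξ θ (M + n)) with hG
  have hlin_le : ‖∑ n ∈ Finset.range X, lin n‖ ≤ 1 / |α| + 2 * X * |α| := by
    have : ∀ n, lin n = expc (β + α * M) * expc (α * n) := by
      intro n
      rw [hlin]
      simp only
      rw [← expc_add, ← expc_add]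
      congr 1
      push_cast; ring
    simp_rw [this]
    rw [← Finset.mul_sum, norm_mul, norm_expc, one_mul]
    exact norm_sum_expc_mul_le hα X
  have hdiff : ∀ n ∈ Finset.range X, ‖G n - lin n‖ ≤ 2 * Real.pi * D +
      (if ∃ m : ℤ, |((M + n : ℕ) : ℝ) * θ - m| ≤ ε then 2 else 0) := by
    intro n _
    split_ifs with hbad
    · have h1 : ‖G n‖ = 1 := by
        simp [hG, beattyPhase, norm_expc]
      have h2 : ‖lin n‖ = 1 := by
        simp only [hlin, norm_mul, norm_expc, mul_one]
      have h3 := norm_sub_le (G n) (lin n)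
      have : 0 ≤ 2 * Real.pi * D := by positivity
      linarith
    · have e := beattyPhase_correlation hq hξ hw le_rfl hbad
      have e1 : G n - lin n = lin n * (expc (-(Int.fract (((M + n : ℕ) : ℝ) * θ) *
          (b * (h * θ - m') + η * q * h))) - 1) := by
        rw [hG]
        simp only
        rw [e, hlin]
        ring
      have h2 : ‖lin n‖ = 1 := by
        simp only [hlin, norm_mul, norm_expc, mul_one]
      rw [e1, norm_mul, h2, one_mul, add_zero]
      refine (norm_expc_sub_one_le _).trans ?_
      gcongr
      rw [abs_neg, abs_mul, abs_of_nonneg (Int.fract_nonneg _)]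
      have h3 : |(b : ℝ) * (h * θ - m') + η * q * h| ≤ D := by
        refine (abs_add_le _ _).trans (le_of_eq ?_)
        rw [abs_mul, abs_mul, abs_mul, Nat.abs_cast, Nat.abs_cast]
      calc _ ≤ 1 * D := by
            gcongr
            exact (Int.fract_lt_one _).le
        _ = D := one_mul _
  have hsum : ‖∑ n ∈ Finset.range X, (G n - lin n)‖ ≤
      X * (2 * Real.pi * D) + 2 * (1 + X * (2 * ε / c)) := by
    refine (norm_sum_le_of_le _ hdiff).trans ?_
    rw [Finset.sum_add_distrib, ← Finset.sum_filter]
    have h1 := card_near_integer_le hc (by positivity : 0 ≤ ε) hθ X M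
    simp only [Finset.sum_const, Finset.card_range, nsmul_eq_mul]
    linarith
  have e : ∑ n ∈ Finset.range X, G n =
      ∑ n ∈ Finset.range X, lin n + ∑ n ∈ Finset.range X, (G n - lin n) := by
    rw [Finset.sum_sub_distrib]; ring
  rw [e]
  refine (norm_add_le _ _).trans ?_
  linarith

set_option maxHeartbeats 1000000 in
theorem norm_sum_beattyPhase_le {θ c : ℝ} {v : ℕ} {u : ℤ} (hc : 0 < c) (hθ0 : 0 < θ) (hv : 0 < v)
    (hvθ : v * θ ^ 2 = u) (hθ : ∀ (d : ℕ) (m : ℤ), 0 < d → c / d ≤ |d * θ - m|) :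
    ∃ C > (0 : ℝ), ∀ (N P ξ η : ℝ) (a b z : ℤ) (q X : ℕ), 1 ≤ P → P ^ 16 ≤ N → 0 < q → q ≤ P →
      |(b : ℝ)| ≤ P → |η| ≤ P / N → P ^ 16 / N ^ 2 ≤ |η| → ξ = (a + b * θ) / q + η + z → X ≤ N →
      ‖∑ n ∈ Finset.range X, beattyPhase ξ θ (1 + n)‖ ≤ C * (N / P) := by
  set K : ℝ := 1 / (c * θ) + 4 * (4 * v * θ + 1) + 2 * Real.pi * (2 + 4 * v) + 2 + 8 / c with hK
  have hK0 : 0 < K := by have := Real.pi_pos; positivity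
  refine ⟨√(1 + K) + 8 * v, by positivity, ?_⟩
  intro N P ξ η a b z q X hP hPN hq hqP hbP hη hη' hξ hXN
  have hP0 : 0 < P := by linarith
  have hN0 : 0 < N := lt_of_lt_of_le (by positivity) hPN
  have hpow : ∀ {i j : ℕ}, i ≤ j → P ^ i ≤ P ^ j := fun h => pow_le_pow_right₀ hP h
  have hvr : (0 : ℝ) < v := by exact_mod_cast hv
  have hqr : (1 : ℝ) ≤ q := by exact_mod_cast hq
  have hq0 : (0 : ℝ) < q := by linarith
  set A := N / P ^ 8 with hA
  have hA1 : 1 ≤ A := by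
    rw [hA, le_div_iff₀ (by positivity), one_mul]
    exact (hpow (by norm_num)).trans hPN
  have hA0 : 0 < A := by linarith
  have hAP : P ^ 8 ≤ A := by
    rw [hA, le_div_iff₀ (by positivity), ← pow_add]
    exact hPN
  obtain ⟨κ, hκ0, hκT, hκ⟩ := Real.exists_nat_abs_mul_sub_round_le (v * θ)
    (Nat.ceil_pos.mpr hA0)
  set m' := round ((κ : ℝ) * (v * θ)) with hm'
  set h : ℕ := κ * v with hh
  have hh0 : 0 < h := Nat.mul_pos hκ0 hv
  have hhr : (0 : ℝ) < h := by exact_mod_cast hh0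
  have hhcast : (h : ℝ) = κ * v := by rw [hh]; push_cast; ring
  have hσ : |(h : ℝ) * θ - m'| ≤ 1 / A := by
    have e : (h : ℝ) * θ - m' = κ * (v * θ) - m' := by rw [hhcast]; ring
    rw [e]
    refine hκ.trans ?_
    gcongr
    linarith [Nat.le_ceil A]
  have hh_lower : c * A ≤ h := by
    have h1 := (hθ h m' hh0).trans hσ
    rw [div_le_div_iff₀ hhr hA0] at h1
    linarith
  have hh_upper : (h : ℝ) ≤ 2 * v * A := by
    have h1 : (κ : ℝ) ≤ ⌈A⌉₊ := by exact_mod_cast hκT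
    have h2 := Nat.ceil_lt_add_one hA0.le
    rw [hhcast]
    nlinarith
  have hσ1 : |(h : ℝ) * θ - m'| ≤ 1 := hσ.trans ((div_le_one hA0).mpr hA1)
  have hm'0 : (0 : ℝ) ≤ m' := by
    have h1 : (-1 : ℝ) < m' := by
      have := (abs_le.mp hσ1).2
      have : 0 < (h : ℝ) * θ := by positivity
      linarith
    have h2 : (-1 : ℤ) < m' := by exact_mod_cast h1
    exact_mod_cast (by omega : 0 ≤ m')
  have hm'_le : (m' : ℝ) ≤ h * θ + 1 := by linarith [(abs_le.mp hσ1).1]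
  have hη0 : 0 < |η| := lt_of_lt_of_le (by positivity) hη'
  set L := ⌈P ^ 2⌉₊ with hL
  have hL1 : P ^ 2 ≤ L := Nat.le_ceil _
  have hL2 : (L : ℝ) ≤ 2 * P ^ 2 := by
    have := Nat.ceil_lt_add_one (by positivity : 0 ≤ P ^ 2)
    have : 1 ≤ P ^ 2 := one_le_pow₀ hP
    linarith
  have hL0 : 0 < L := Nat.ceil_pos.mpr (by positivity)
  have hX0 : (0 : ℝ) ≤ X := by positivity
  have hcorr : ∀ g M : ℕ, 1 ≤ g → g < L →
      ‖∑ n ∈ Finset.range X, beattyPhase ξ θ (M + n + g * (q * h)) *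
        (starRingEnd ℂ) (beattyPhase ξ θ (M + n))‖ ≤ K * (N / P ^ 4) := by
    intro g M hg hgL
    have hgr : (1 : ℝ) ≤ g := by exact_mod_cast hg
    have hgL' : (g : ℝ) ≤ 2 * P ^ 2 := le_trans (by exact_mod_cast hgL.le) hL2
    have hαabs : |η * q * (((g * h : ℕ) : ℝ) * θ + ((g * m' : ℤ) : ℝ))| =
        g * (|η| * q * (h * θ + m')) := by
      have e : η * q * (((g * h : ℕ) : ℝ) * θ + ((g * m' : ℤ) : ℝ)) =
          η * (g * q * (h * θ + m')) := by push_cast; ring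
      rw [e, abs_mul, abs_of_nonneg (by positivity : 0 ≤ (g : ℝ) * q * (h * θ + m'))]
      ring
    have hlow : c * θ * (P ^ 8 / N) ≤ g * (|η| * q * (h * θ + m')) := by
      calc c * θ * (P ^ 8 / N) = 1 * (P ^ 16 / N ^ 2 * 1 * (c * A * θ + 0)) := by
            rw [hA]; field_simp; ring
        _ ≤ g * (|η| * q * (h * θ + m')) := by gcongr
    have hlow0 : 0 < c * θ * (P ^ 8 / N) := by positivity
    have hup : g * (|η| * q * (h * θ + m')) ≤ 2 * (4 * v * θ + 1) * (1 / P ^ 4) := by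
      have h1 : (h : ℝ) * θ + m' ≤ (4 * v * θ + 1) * A := by
        have h2 : (h : ℝ) * θ ≤ 2 * v * A * θ := by gcongr
        linarith
      calc g * (|η| * q * (h * θ + m')) ≤ 2 * P ^ 2 * (P / N * P * ((4 * v * θ + 1) * A)) := by
            gcongr
        _ = 2 * (4 * v * θ + 1) * (1 / P ^ 4) := by rw [hA]; field_simp
    have hgσ : |((g * h : ℕ) : ℝ) * θ - ((g * m' : ℤ) : ℝ)| ≤ 2 * P ^ 2 * (1 / A) := by
      have e : ((g * h : ℕ) : ℝ) * θ - ((g * m' : ℤ) : ℝ) = g * (h * θ - m') := by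
        push_cast; ring
      rw [e, abs_mul, Nat.abs_cast]
      gcongr
    have hPA : P ^ 3 * (1 / A) ≤ 1 / P ^ 4 := by
      rw [mul_one_div, div_le_div_iff₀ hA0 (by positivity), one_mul, ← pow_add]
      exact (hpow (by norm_num)).trans hAP
    have hD : |(b : ℝ)| * |((g * h : ℕ) : ℝ) * θ - ((g * m' : ℤ) : ℝ)| +
        |η| * q * ((g * h : ℕ) : ℝ) ≤ (2 + 4 * v) * (1 / P ^ 4) := by
      have h1 : |(b : ℝ)| * |((g * h : ℕ) : ℝ) * θ - ((g * m' : ℤ) : ℝ)| ≤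
          2 * (P ^ 3 * (1 / A)) := by
        calc _ ≤ P * (2 * P ^ 2 * (1 / A)) := by gcongr
          _ = _ := by ring
      have h2 : |η| * q * ((g * h : ℕ) : ℝ) ≤ 4 * v * (1 / P ^ 4) := by
        push_cast
        calc |η| * q * ((g : ℝ) * h) ≤ P / N * P * (2 * P ^ 2 * (2 * v * A)) := by gcongr
          _ = 4 * v * (1 / P ^ 4) := by rw [hA]; field_simp; ring
      linarith
    have hbad : (q : ℝ) * |((g * h : ℕ) : ℝ) * θ - ((g * m' : ℤ) : ℝ)| ≤ 2 * (1 / P ^ 4) := by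
      calc _ ≤ P * (2 * P ^ 2 * (1 / A)) := by gcongr
        _ = 2 * (P ^ 3 * (1 / A)) := by ring
        _ ≤ _ := by gcongr
    have hw : ((g * h : ℕ) : ℝ) * θ ^ 2 = ((g * κ * u : ℤ) : ℝ) := by
      push_cast
      rw [hhcast, ← hvθ]; ring
    have hα0 : η * q * (((g * h : ℕ) : ℝ) * θ + ((g * m' : ℤ) : ℝ)) ≠ 0 := by
      rw [← abs_pos, hαabs]; linarith
    have main := norm_correlation_le hc hθ hq hξ hw hα0 X M
    rw [show q * (g * h) = g * (q * h) by ring, hαabs] at main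
    refine main.trans ?_
    have t1 : 1 / (g * (|η| * q * (h * θ + m'))) ≤ 1 / (c * θ) * (N / P ^ 4) := by
      calc _ ≤ 1 / (c * θ * (P ^ 8 / N)) := one_div_le_one_div_of_le hlow0 hlow
        _ = 1 / (c * θ) * (N / P ^ 8) := by field_simp
        _ ≤ _ := by
          have := hpow (show 4 ≤ 8 by norm_num)
          gcongr
    have t2 : 2 * X * (g * (|η| * q * (h * θ + m'))) ≤ 4 * (4 * v * θ + 1) * (N / P ^ 4) := by
      calc _ ≤ 2 * N * (2 * (4 * v * θ + 1) * (1 / P ^ 4)) := by gcongr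
        _ = _ := by ring
    have t3 : X * (2 * Real.pi * (|(b : ℝ)| * |((g * h : ℕ) : ℝ) * θ - ((g * m' : ℤ) : ℝ)| +
        |η| * q * ((g * h : ℕ) : ℝ))) ≤ 2 * Real.pi * (2 + 4 * v) * (N / P ^ 4) := by
      have := Real.pi_pos
      calc _ ≤ N * (2 * Real.pi * ((2 + 4 * v) * (1 / P ^ 4))) := by gcongr
        _ = _ := by ring
    have t4 : 2 * (1 + X * (2 * (q * |((g * h : ℕ) : ℝ) * θ - ((g * m' : ℤ) : ℝ)|) / c)) ≤
        (2 + 8 / c) * (N / P ^ 4) := by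
      have h1 : 1 ≤ N / P ^ 4 := by
        rw [le_div_iff₀ (by positivity), one_mul]
        exact (hpow (by norm_num)).trans hPN
      calc _ ≤ 2 * (N / P ^ 4 + N * (2 * (2 * (1 / P ^ 4)) / c)) := by gcongr
        _ = _ := by ring
    rw [hK]
    linarith
  have hvdc := norm_sum_le_of_correlations (f := beattyPhase ξ θ)
    (fun n => (norm_expc _).le) hL0 (by positivity) hcorr 1
  refine hvdc.trans ?_
  have s1 : √((X : ℝ) ^ 2 / L + X * (K * (N / P ^ 4))) ≤ √(1 + K) * (N / P) := by
    rw [← Real.sqrt_sq (by positivity : 0 ≤ N / P), ← Real.sqrt_mul (by positivity)]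
    apply Real.sqrt_le_sqrt
    have := hpow (show 2 ≤ 4 by norm_num)
    calc _ ≤ N ^ 2 / P ^ 2 + N * (K * (N / P ^ 2)) := by gcongr
      _ = _ := by ring
  have s2 : 2 * (L * ((q * h : ℕ) : ℝ)) ≤ 8 * v * (N / P) := by
    push_cast
    calc 2 * ((L : ℝ) * (q * h)) ≤ 2 * (2 * P ^ 2 * (P * (2 * v * A))) := by gcongr
      _ = 8 * v * (N / P ^ 5) := by rw [hA]; field_simp; ring
      _ ≤ 8 * v * (N / P) := by
        have := hpow (show 1 ≤ 5 by norm_num)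
        rw [pow_one] at this
        gcongr
  linarith

/-- Square roots of rationals are badly approximable. -/
theorem exists_div_le_abs_mul_sqrt_sub {k : ℚ} (hk : 0 < k) (hirr : Irrational √(k : ℝ)) :
    ∃ c > (0 : ℝ), ∀ (d : ℕ) (m : ℤ), 0 < d → c / d ≤ |d * √(k : ℝ) - m| := by
  set θ := √(k : ℝ) with hθ
  have hk' : (0 : ℝ) < k := by exact_mod_cast hk
  have hθ0 : 0 < θ := Real.sqrt_pos.mpr hk'
  have hsq : θ ^ 2 = k := Real.sq_sqrt hk'.le
  have hv : (1 : ℝ) ≤ k.den := by exact_mod_cast k.pos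
  have hkd : (k : ℝ) * k.den = k.num := by exact_mod_cast Rat.mul_den_eq_num k
  refine ⟨1 / (k.den * (2 * θ + 1)), by positivity, fun d m hd => ?_⟩
  have hd1 : (1 : ℝ) ≤ d := by exact_mod_cast hd
  rw [div_div, div_le_iff₀ (by positivity)]
  rcases le_or_gt |d * θ - m| 1 with h | h
  · have hprod : (k.den : ℝ) * ((d * θ - m) * (d * θ + m)) =
        ((d ^ 2 * k.num - k.den * m ^ 2 : ℤ) : ℝ) := by
      push_cast
      rw [← hkd, ← hsq]; ring
    have hne : ∀ j : ℤ, (d : ℝ) * θ + j ≠ 0 := fun j =>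
      ((hirr.natCast_mul hd.ne').add_intCast j).ne_zero
    have hint : (d ^ 2 * k.num - k.den * m ^ 2 : ℤ) ≠ 0 := by
      intro h0
      rw [h0, Int.cast_zero] at hprod
      have h1 : (d : ℝ) * θ - m ≠ 0 := by simpa [sub_eq_add_neg] using hne (-m)
      exact mul_ne_zero (by positivity) (mul_ne_zero h1 (hne m)) hprod
    have h1 : (1 : ℝ) ≤ |(k.den : ℝ) * ((d * θ - m) * (d * θ + m))| := by
      rw [hprod]
      exact_mod_cast Int.one_le_abs hint
    rw [abs_mul, abs_mul, Nat.abs_cast] at h1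
    have h2 : |(d : ℝ) * θ + m| ≤ d * (2 * θ + 1) := by
      have h3 := abs_le.mp h
      rw [abs_le]
      have : 0 < (d : ℝ) * θ := by positivity
      constructor <;> nlinarith [h3.1, h3.2]
    calc 1 ≤ (k.den : ℝ) * (|d * θ - m| * |d * θ + m|) := h1
      _ ≤ k.den * (|d * θ - m| * (d * (2 * θ + 1))) := by gcongr
      _ = _ := by ring
  · have h1 : (1 : ℝ) ≤ k.den * (2 * θ + 1) := by nlinarith
    have h2 : (1 : ℝ) ≤ k.den * (2 * θ + 1) * d := by nlinarith
    nlinarith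

/-- **Estimate for `m₂`** (Lemma: minor arcs, part 2).
Let `k` be a positive rational with `√k` irrational.  Then there is an absolute constant
`c₀ > 0` such that for all `γ, γ' ∈ (0, 1/10)` with `γ/γ' < c₀` there exist constants
`χ = χ(γ, γ') > 0` and `C = C(k, γ, γ') > 0` such that for every `N ≥ 1` and every
`ξ ∈ m₂(N; k, γ, γ')`, `|(1/N) ∑_{n=1}^{⌊N⌋} e(ξ n⌊n√k⌋)| ≤ C N^{−χ}`. -/
theorem minor_arc_estimate_m2 :
    ∃ c₀ > (0 : ℝ), ∀ (γ γ' : ℝ),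
      γ ∈ Set.Ioo (0 : ℝ) (1 / 10) → γ' ∈ Set.Ioo (0 : ℝ) (1 / 10) → γ / γ' < c₀ →
      ∃ χ > (0 : ℝ), ∀ (k : ℚ), 0 < k → Irrational (Real.sqrt (k : ℝ)) →
        ∃ C > (0 : ℝ), ∀ (N : ℝ), 1 ≤ N →
          ∀ ξ ∈ minor2 (k : ℝ) N γ γ',
            ‖expSum (k : ℝ) N ξ‖ ≤ C * N ^ (-χ) := by
  refine ⟨1 / 16, by norm_num, fun γ γ' hγ hγ' hlt => ⟨γ' / 16, by linarith [hγ'.1], ?_⟩⟩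
  intro k hk hirr
  have hγ'0 : 0 < γ' := hγ'.1
  have hγle : γ ≤ γ' / 16 := by
    rw [div_lt_iff₀ hγ'0] at hlt
    linarith
  have hk' : (0 : ℝ) < k := by exact_mod_cast hk
  obtain ⟨c, hc, hbad⟩ := exists_div_le_abs_mul_sqrt_sub hk hirr
  have hvθ : ((k.den : ℕ) : ℝ) * √(k : ℝ) ^ 2 = (k.num : ℝ) := by
    rw [Real.sq_sqrt hk'.le, mul_comm]
    exact_mod_cast Rat.mul_den_eq_num k
  obtain ⟨C, hC, hmain⟩ := norm_sum_beattyPhase_le hc (Real.sqrt_pos.mpr hk') k.pos hvθ hbad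
  refine ⟨C, hC, fun N hN ξ hξ => ?_⟩
  obtain ⟨⟨hξI, a, b, q, hidx, hwide⟩, hnot⟩ := hξ
  have hN0 : 0 < N := by linarith
  have hfar : N ^ (-2 + γ') < distToInt (ξ - ((a : ℝ) + (b : ℝ) * √(k : ℝ)) / q) := by
    by_contra! hle
    exact hnot ⟨hξI, a, b, q, hidx, hle⟩
  obtain ⟨hq, hqN, hbN, -⟩ := hidx
  set P := N ^ (γ' / 16) with hP
  have hγP : N ^ γ ≤ P := Real.rpow_le_rpow_of_exponent_le hN hγle
  have hP1 : 1 ≤ P := Real.one_le_rpow hN (by positivity)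
  have hP16 : P ^ 16 = N ^ γ' := by
    rw [hP, ← Real.rpow_natCast, ← Real.rpow_mul hN0.le]
    congr 1
    push_cast; ring
  have hPN : P ^ 16 ≤ N := by
    rw [hP16]
    simpa using Real.rpow_le_rpow_of_exponent_le hN (show γ' ≤ 1 by linarith [hγ'.2])
  set y := ξ - ((a : ℝ) + (b : ℝ) * √(k : ℝ)) / q with hy
  have hη : |y - round y| ≤ P / N := by
    refine hwide.trans ?_
    rw [Real.rpow_add hN0, Real.rpow_neg_one, div_eq_inv_mul]
    gcongr
  have hη' : P ^ 16 / N ^ 2 ≤ |y - round y| := by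
    refine le_trans (le_of_eq ?_) hfar.le
    rw [hP16, Real.rpow_add hN0, Real.rpow_neg hN0.le, div_eq_inv_mul]
    norm_num
  have hX : ((⌊N⌋.toNat : ℕ) : ℝ) ≤ N := by
    have h1 : ((⌊N⌋.toNat : ℤ) : ℝ) = ⌊N⌋ := by
      rw [Int.toNat_of_nonneg (Int.floor_nonneg.mpr hN0.le)]
    rw [← Int.cast_natCast, h1]
    exact Int.floor_le N
  have hsum := hmain N P ξ (y - round y) a b (round y) q ⌊N⌋.toNat hP1 hPN hq (hqN.trans hγP)
    (hbN.trans hγP) hη hη' (by rw [hy]; ring) hX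
  have e : ∑ n ∈ Finset.Icc 1 ⌊N⌋.toNat,
      expc (ξ * ((n : ℝ) * (⌊(n : ℝ) * √(k : ℝ)⌋ : ℝ))) =
      ∑ n ∈ Finset.range ⌊N⌋.toNat, beattyPhase ξ √(k : ℝ) (1 + n) := by
    rw [← Finset.Ico_add_one_right_eq_Icc, Finset.sum_Ico_eq_sum_range]
    rfl
  rw [expSum, e, norm_mul, norm_inv, Complex.norm_real, Real.norm_eq_abs, abs_of_pos hN0,
    Real.rpow_neg hN0.le, ← hP]
  calc N⁻¹ * _ ≤ N⁻¹ * (C * (N / P)) := by gcongr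
    _ = C * P⁻¹ := by field_simp
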